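/- arXiv:2410.20985 — 3 statements merged into one kernel-verified Lean document; each statement's English description precedes it below -/
import Mathlib

section
/- Let p, q ∈ ℂ[z₁,…,zₙ] be polynomials with no common nonconstant factor such that q has no zeros on the polydisc 𝔻ⁿ, and suppose that φ := (z₁⋯zₙ · p)/q is a rational inner function on 𝔻ⁿ. Then for every α ∈ 𝕋 and every Clark measure μ_α of φ at α one has H²(μ_α) = L²(μ_α). -/
open MeasureTheory Filter Set
open scoped ENNReal

noncomputable section

/-- We endow finite-dimensional complex Euclidean spaces with their Borel σ-algebra. -/
instance {ι : Type*} [Fintype ι] : MeasurableSpace (EuclideanSpace ℂ ι) := borel _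
instance {ι : Type*} [Fintype ι] : BorelSpace (EuclideanSpace ℂ ι) := ⟨rfl⟩

/-- Evaluation of a polynomial in the variables `ι` at a point of `ℂ^ι`. -/
def pEval {ι : Type*} (p : MvPolynomial ι ℂ) (z : EuclideanSpace ℂ ι) : ℂ :=
  MvPolynomial.eval (fun i => z i) p

/-- The open unit polydisc `𝔻ⁿ` in `ℂⁿ`. -/
def polydisc (n : ℕ) : Set (EuclideanSpace ℂ (Fin n)) := {z | ∀ j, ‖z j‖ < 1}

/-- The unit torus `𝕋^ι` in `ℂ^ι`. -/
def torus (ι : Type*) : Set (EuclideanSpace ℂ ι) := {ζ | ∀ j, ‖ζ j‖ = 1}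

/-- `φ` has radial limit `α` at `ζ`: `φ(ρζ) → α` as `ρ → 1⁻`. -/
def HasRadialLimit {n : ℕ} (φ : EuclideanSpace ℂ (Fin n) → ℂ)
    (ζ : EuclideanSpace ℂ (Fin n)) (α : ℂ) : Prop :=
  Tendsto (fun ρ : ℝ => φ ((ρ : ℂ) • ζ)) (nhdsWithin 1 (Set.Iio 1)) (nhds α)

/-- `φ` is the rational inner function `p/q` on the polydisc `𝔻ⁿ`: `p, q` have no common
nonconstant factor, `q` is zero-free on `𝔻ⁿ`, `|φ| < 1` on `𝔻ⁿ`, and for a.e. `ζ ∈ 𝕋ⁿ`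
(w.r.t. the Haar measure of `𝕋ⁿ`, i.e. up to an `ℋⁿ`-null set) the radial limit of `φ` at `ζ`
exists and is unimodular. -/
structure IsRationalInner (n : ℕ) (p q : MvPolynomial (Fin n) ℂ)
    (φ : EuclideanSpace ℂ (Fin n) → ℂ) : Prop where
  coprime : ∀ d : MvPolynomial (Fin n) ℂ, d ∣ p → d ∣ q → IsUnit d
  q_ne_zero : ∀ z ∈ polydisc n, pEval q z ≠ 0
  phi_eq : ∀ z ∈ polydisc n, φ z = pEval p z / pEval q z
  abs_lt_one : ∀ z ∈ polydisc n, ‖φ z‖ < 1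
  inner : ∃ E ⊆ torus (Fin n), μH[(n : ℝ)] E = 0 ∧
    ∀ ζ ∈ torus (Fin n) \ E, ∃ β : ℂ, ‖β‖ = 1 ∧ HasRadialLimit φ ζ β

/-- `μ` is a Clark measure of `φ` at `α`: a finite positive Borel measure on `𝕋ⁿ` whose
Poisson–Szegő integral is `(1-|φ|²)/|α-φ|²`. -/
def IsClarkMeasure (n : ℕ) (φ : EuclideanSpace ℂ (Fin n) → ℂ) (α : ℂ)
    (μ : Measure (EuclideanSpace ℂ (Fin n))) : Prop :=
  IsFiniteMeasure μ ∧ μ (torus (Fin n))ᶜ = 0 ∧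
    ∀ z ∈ polydisc n,
      ∫⁻ ζ, ENNReal.ofReal (∏ j, (1 - ‖z j‖ ^ 2) / ‖ζ j - z j‖ ^ 2) ∂μ
        = ENNReal.ofReal ((1 - ‖φ z‖ ^ 2) / ‖α - φ z‖ ^ 2)

/-- The subset of `L²(μ)` consisting of (classes of) holomorphic polynomial functions;
`H²(μ)` is its closure in `L²(μ)`. -/
def polyLp (n : ℕ) (μ : Measure (EuclideanSpace ℂ (Fin n))) : Set (Lp ℂ 2 μ) :=
  {f | ∃ p : MvPolynomial (Fin n) ℂ, ⇑f =ᵐ[μ] pEval p}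

/-- `φ₁⁻¹(α)`: the set of `ζ ∈ 𝕋ⁿ` where the radial limit of `φ` exists and equals `α`. -/
def radialFiber {n : ℕ} (φ : EuclideanSpace ℂ (Fin n) → ℂ) (α : ℂ) :
    Set (EuclideanSpace ℂ (Fin n)) :=
  {ζ | ζ ∈ torus (Fin n) ∧ HasRadialLimit φ ζ α}

/-- The common zero set in `ℂ^ι` of a finite family of real polynomials in the real and
imaginary parts of the coordinates. -/
def realZeroSet {ι : Type*} (s : Finset (MvPolynomial (ι × Bool) ℝ)) :
    Set (EuclideanSpace ℂ ι) :=
  {w | ∀ P ∈ s, MvPolynomial.eval (fun ib => if ib.2 then (w ib.1).re else (w ib.1).im) P = 0}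

/-- The projection `ℂⁿ → ℂ^{n-1}` deleting the `j`-th coordinate. -/
def deleteCoord {n : ℕ} (j : Fin n) (ζ : EuclideanSpace ℂ (Fin n)) :
    EuclideanSpace ℂ {i : Fin n // i ≠ j} :=
  (WithLp.equiv 2 _).symm fun i => ζ i.1

@[fun_prop]
theorem continuous_pEval {ι : Type*} (p : MvPolynomial ι ℂ) : Continuous (pEval p) := by
  unfold pEval
  exact (MvPolynomial.continuous_eval p).comp (by fun_prop)

/-- The closed unit polydisc. -/
def closedPolydisc (n : ℕ) : Set (EuclideanSpace ℂ (Fin n)) := {z | ∀ j, ‖z j‖ ≤ 1}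

theorem isCompact_closedPolydisc (n : ℕ) : IsCompact (closedPolydisc n) := by
  have h : closedPolydisc n = (EuclideanSpace.equiv (Fin n) ℂ) ⁻¹' Set.pi univ
      fun _ => Metric.closedBall 0 1 := by
    ext z; simp [closedPolydisc]
  rw [h]
  exact (EuclideanSpace.equiv (Fin n) ℂ).toHomeomorph.isCompact_preimage.2
    (isCompact_univ_pi fun _ => isCompact_closedBall 0 1)

theorem torus_subset_closedPolydisc (n : ℕ) : torus (Fin n) ⊆ closedPolydisc n :=
  fun _ hz j => (hz j).le

theorem isClosed_torus (n : ℕ) : IsClosed (torus (Fin n)) := by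
  simp only [torus, ofPred_forall]
  exact isClosed_iInter fun j => isClosed_eq (by fun_prop) continuous_const

theorem isCompact_torus (n : ℕ) : IsCompact (torus (Fin n)) :=
  (isCompact_closedPolydisc n).of_isClosed_subset (isClosed_torus n) (torus_subset_closedPolydisc n)

theorem smul_mem_polydisc {n : ℕ} {r : ℝ} (hr₀ : 0 ≤ r) (hr₁ : r < 1)
    {z : EuclideanSpace ℂ (Fin n)} (hz : z ∈ closedPolydisc n) : (r : ℂ) • z ∈ polydisc n := by
  intro j
  simp only [PiLp.smul_apply, norm_smul, Complex.norm_real, Real.norm_eq_abs, abs_of_nonneg hr₀]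
  nlinarith [hz j, norm_nonneg (z j)]

/-- The polynomial `z ↦ P (c z)`. -/
def dilate {n : ℕ} (c : ℂ) (P : MvPolynomial (Fin n) ℂ) : MvPolynomial (Fin n) ℂ :=
  MvPolynomial.bind₁ (fun j => MvPolynomial.C c * MvPolynomial.X j) P

theorem pEval_dilate {n : ℕ} (c : ℂ) (P : MvPolynomial (Fin n) ℂ)
    (z : EuclideanSpace ℂ (Fin n)) : pEval (dilate c P) z = pEval P (c • z) := by
  simp only [pEval, dilate, MvPolynomial.eval, MvPolynomial.eval₂Hom_bind₁]
  simp

/-- Restriction of polynomials to a set, as an algebra homomorphism to continuous functions. -/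
def polyRestrict {n : ℕ} (K : Set (EuclideanSpace ℂ (Fin n))) :
    MvPolynomial (Fin n) ℂ →ₐ[ℂ] C(K, ℂ) :=
  MvPolynomial.aeval fun j => ⟨fun z => (z : EuclideanSpace ℂ (Fin n)) j, by fun_prop⟩

theorem polyRestrict_apply {n : ℕ} (K : Set (EuclideanSpace ℂ (Fin n)))
    (P : MvPolynomial (Fin n) ℂ) (z : K) : polyRestrict K P z = pEval P z := by
  induction P using MvPolynomial.induction_on with
  | C a => simp [polyRestrict, pEval]
  | add p q hp hq => simp_all [pEval]
  | mul_X p j hp => simp_all [pEval]; left; simp [polyRestrict]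

/-- In a commutative Banach algebra, a polynomial in contractions whose zero set misses the closed
polydisc of radius `1` is invertible. -/
theorem isUnit_algHom_of_pEval_ne_zero {n : ℕ} {A : Type*} [NormedCommRing A] [NormedAlgebra ℂ A]
    [CompleteSpace A] [NormOneClass A] (ρ : MvPolynomial (Fin n) ℂ →ₐ[ℂ] A)
    (hρ : ∀ j, ‖ρ (MvPolynomial.X j)‖ ≤ 1) {Q : MvPolynomial (Fin n) ℂ}
    (hQ : ∀ z ∈ closedPolydisc n, pEval Q z ≠ 0) : IsUnit (ρ Q) := by
  by_contra hn
  obtain ⟨χ, hχ⟩ := WeakDual.CharacterSpace.exists_apply_eq_zero hn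
  let X : MvPolynomial (Fin n) ℂ →ₐ[ℂ] ℂ := (WeakDual.CharacterSpace.toAlgHom χ).comp ρ
  let a : EuclideanSpace ℂ (Fin n) := WithLp.toLp 2 fun j => X (MvPolynomial.X j)
  have ha : X Q = pEval Q a := by
    have : X = MvPolynomial.aeval (fun j => X (MvPolynomial.X j)) := by
      ext j; simp
    rw [this, pEval, MvPolynomial.aeval_def, MvPolynomial.eval, MvPolynomial.coe_eval₂Hom]
    rfl
  refine hQ a (fun j => ?_) (ha ▸ hχ)
  exact (AlgHom.norm_apply_le_self (WeakDual.CharacterSpace.toAlgHom χ) _).trans (hρ j)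

theorem exists_mem_closure_range_mul_eq_one {n : ℕ} {B : Type*} [NormedCommRing B]
    [NormedAlgebra ℂ B] [CompleteSpace B] [NormOneClass B] (ρ : MvPolynomial (Fin n) ℂ →ₐ[ℂ] B)
    (hρ : ∀ j, ‖ρ (MvPolynomial.X j)‖ ≤ 1) {Q : MvPolynomial (Fin n) ℂ}
    (hQ : ∀ z ∈ closedPolydisc n, pEval Q z ≠ 0) :
    ∃ b ∈ ρ.range.topologicalClosure, ρ Q * b = 1 := by
  have : CompleteSpace ρ.range.topologicalClosure :=
    (Subalgebra.isClosed_topologicalClosure _).completeSpace_coe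
  have : NormOneClass ρ.range.topologicalClosure := ⟨norm_one (α := B)⟩
  obtain ⟨b, hb⟩ := (isUnit_algHom_of_pEval_ne_zero (ρ.codRestrict ρ.range.topologicalClosure
    fun f => Subalgebra.le_topologicalClosure _ ⟨f, rfl⟩) hρ hQ).exists_right_inv
  exact ⟨b, b.2, congrArg Subtype.val hb⟩

/-- A quotient of polynomials with denominator zero-free on the open polydisc is, after dilation,
a uniform limit of polynomials on the closed polydisc. -/
theorem exists_pEval_approx_div {n : ℕ} (P Q : MvPolynomial (Fin n) ℂ)
    (hQ : ∀ z ∈ polydisc n, pEval Q z ≠ 0) {r : ℝ} (hr₀ : 0 ≤ r) (hr₁ : r < 1)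
    {ε : ℝ} (hε : 0 < ε) :
    ∃ f : MvPolynomial (Fin n) ℂ, ∀ z ∈ closedPolydisc n,
      ‖pEval f z - pEval P ((r : ℂ) • z) / pEval Q ((r : ℂ) • z)‖ < ε := by
  let K := closedPolydisc n
  have : CompactSpace K := isCompact_iff_compactSpace.1 (isCompact_closedPolydisc n)
  have : Nonempty K := ⟨⟨0, fun j => by simp⟩⟩
  have hX : ∀ j, ‖polyRestrict K (MvPolynomial.X j)‖ ≤ 1 := by
    refine fun j => (ContinuousMap.norm_le _ zero_le_one).2 fun z => ?_
    rw [polyRestrict_apply]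
    simpa [pEval] using z.2 j
  obtain ⟨b, hbA, hb⟩ := exists_mem_closure_range_mul_eq_one (polyRestrict K) hX
    (Q := dilate r Q) fun z hz => by
      rw [pEval_dilate]
      exact hQ _ (smul_mem_polydisc hr₀ hr₁ hz)
  have hcl := (polyRestrict K).range.topologicalClosure.mul_mem
    (Subalgebra.le_topologicalClosure _ ⟨dilate r P, rfl⟩) hbA
  obtain ⟨_, ⟨f, rfl⟩, hf⟩ := Metric.mem_closure_iff.1 hcl ε hε
  refine ⟨f, fun z hz => ?_⟩
  have hbz : pEval Q ((r : ℂ) • z) * b ⟨z, hz⟩ = 1 := by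
    have := congrArg (fun g : C(K, ℂ) => g ⟨z, hz⟩) hb
    simpa [polyRestrict_apply, pEval_dilate] using this
  have hval : pEval P ((r : ℂ) • z) / pEval Q ((r : ℂ) • z)
      = pEval P ((r : ℂ) • z) * b ⟨z, hz⟩ := by
    rw [div_eq_iff (left_ne_zero_of_mul_eq_one hbz), mul_assoc, mul_comm _ (pEval Q _), hbz,
      mul_one]
  have := (ContinuousMap.dist_apply_le_dist ⟨z, hz⟩).trans_lt hf
  change dist (polyRestrict K (dilate r P) ⟨z, hz⟩ * b ⟨z, hz⟩) (polyRestrict K f ⟨z, hz⟩) < ε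
    at this
  rw [polyRestrict_apply, polyRestrict_apply, pEval_dilate] at this
  rwa [hval, ← dist_eq_norm, dist_comm]

/-- The Poisson kernel of the polydisc. -/
def polyPoisson {n : ℕ} (z ζ : EuclideanSpace ℂ (Fin n)) : ℝ :=
  ∏ j, (1 - ‖z j‖ ^ 2) / ‖ζ j - z j‖ ^ 2

/-- The standard parametrization of the torus by `ℝⁿ`, of period `1` in every variable. -/
def expTorus {n : ℕ} (θ : Fin n → ℝ) : EuclideanSpace ℂ (Fin n) :=
  WithLp.toLp 2 fun j => circleMap 0 1 (2 * Real.pi * θ j)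

/-- Lebesgue measure on the unit cube; `expTorus` carries it to the Haar measure of the torus. -/
def cubeMeasure (n : ℕ) : Measure (Fin n → ℝ) :=
  Measure.pi fun _ => volume.restrict (Ioc 0 1)

instance (n : ℕ) : IsProbabilityMeasure (cubeMeasure n) := by
  have : IsProbabilityMeasure (volume.restrict (Ioc (0 : ℝ) 1)) := ⟨by simp⟩
  unfold cubeMeasure; infer_instance

theorem cubeMeasure_eq (n : ℕ) :
    cubeMeasure n = volume.restrict (Set.pi univ fun _ => Ioc 0 1) := by
  rw [volume_pi, Measure.restrict_pi_pi]; rfl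

theorem expTorus_mem {n : ℕ} (θ : Fin n → ℝ) : expTorus θ ∈ torus (Fin n) := by
  intro j; simp [expTorus]

@[fun_prop]
theorem continuous_expTorus {n : ℕ} : Continuous (expTorus (n := n)) := by
  unfold expTorus; fun_prop

theorem Continuous.integrable_cubeMeasure {n : ℕ} {E : Type*} [NormedAddCommGroup E]
    {f : (Fin n → ℝ) → E} (hf : Continuous f) : Integrable f (cubeMeasure n) := by
  rw [cubeMeasure_eq]
  refine IntegrableOn.mono_set (t := Icc 0 1) (hf.integrableOn_Icc) ?_
  intro x hx
  exact ⟨fun j => (hx j trivial).1.le, fun j => (hx j trivial).2⟩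

theorem ne_of_norm_lt_one {a b : ℂ} (ha : ‖a‖ = 1) (hb : ‖b‖ < 1) : a - b ≠ 0 := by
  rintro h
  rw [sub_eq_zero.1 h] at ha
  linarith

theorem continuous_polyPoisson_expTorus {n : ℕ} {z : EuclideanSpace ℂ (Fin n)}
    (hz : z ∈ polydisc n) : Continuous fun θ => polyPoisson z (expTorus θ) := by
  unfold polyPoisson
  refine continuous_finsetProd _ fun j _ => Continuous.div (by fun_prop) (by fun_prop) fun θ => ?_
  exact pow_ne_zero 2 (norm_ne_zero_iff.2 (ne_of_norm_lt_one (expTorus_mem θ j) (hz j)))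

theorem integral_poisson_pow {w : ℂ} (hw : ‖w‖ < 1) (k : ℕ) :
    ∫ t in Ioc (0 : ℝ) 1, (((1 - ‖w‖ ^ 2) / ‖circleMap 0 1 (2 * Real.pi * t) - w‖ ^ 2 : ℝ) : ℂ)
      * circleMap 0 1 (2 * Real.pi * t) ^ k = w ^ k := by
  have h := DiffContOnCl.circleAverage_poissonKernel_smul (f := fun z : ℂ => z ^ k) (c := 0)
    (R := 1) (w := w) (Differentiable.diffContOnCl (by fun_prop)) (by simpa using hw)
  rw [← h, Real.circleAverage_def, ← intervalIntegral.integral_of_le zero_le_one]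
  have h2 := intervalIntegral.integral_comp_mul_left (a := 0) (b := 1) (fun x : ℝ =>
    (((1 - ‖w‖ ^ 2) / ‖circleMap 0 1 x - w‖ ^ 2 : ℝ) : ℂ) * circleMap 0 1 x ^ k)
    (c := 2 * Real.pi) (by positivity)
  rw [h2]
  simp [poissonKernel]

theorem integral_polyPoisson_mul_pEval {n : ℕ} {z : EuclideanSpace ℂ (Fin n)}
    (hz : z ∈ polydisc n) (f : MvPolynomial (Fin n) ℂ) :
    ∫ θ, (polyPoisson z (expTorus θ) : ℂ) * pEval f (expTorus θ) ∂cubeMeasure n = pEval f z := by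
  have hc := continuous_polyPoisson_expTorus hz
  induction f using MvPolynomial.induction_on' with
  | monomial u a =>
    have h1 : ∀ θ : Fin n → ℝ, (polyPoisson z (expTorus θ) : ℂ)
        * pEval (MvPolynomial.monomial u a) (expTorus θ)
        = a * ∏ j, ((((1 - ‖z j‖ ^ 2) / ‖circleMap 0 1 (2 * Real.pi * θ j) - z j‖ ^ 2 : ℝ) : ℂ)
          * circleMap 0 1 (2 * Real.pi * θ j) ^ u j) := by
      intro θ
      rw [Finset.prod_mul_distrib, pEval, MvPolynomial.eval_monomial, Finsupp.prod_fintype _ _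
        (by simp), polyPoisson, Complex.ofReal_prod]
      simp only [expTorus]
      ring
    simp_rw [h1]
    rw [integral_const_mul, cubeMeasure, integral_fintype_prod_eq_prod (fun j t =>
      ((((1 - ‖z j‖ ^ 2) / ‖circleMap 0 1 (2 * Real.pi * t) - z j‖ ^ 2 : ℝ) : ℂ)
          * circleMap 0 1 (2 * Real.pi * t) ^ u j))]
    simp_rw [integral_poisson_pow (hz _)]
    rw [pEval, MvPolynomial.eval_monomial, Finsupp.prod_fintype _ _ (by simp)]
  | add p q hp hq =>
    have hadd : ∀ w, pEval (p + q) w = pEval p w + pEval q w := fun w => by simp [pEval]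
    simp_rw [hadd, mul_add]
    rw [integral_add (Continuous.integrable_cubeMeasure (by fun_prop))
      (Continuous.integrable_cubeMeasure (by fun_prop)), hp, hq]

theorem norm_sub_le_norm_circleMap_sub {a b : ℝ} (h : |a - b| ≤ 1 / 2) :
    |a - b| ≤ ‖circleMap 0 1 (2 * Real.pi * a) - circleMap 0 1 (2 * Real.pi * b)‖ := by
  have h1 : ‖circleMap 0 1 (2 * Real.pi * a) - circleMap 0 1 (2 * Real.pi * b)‖
      = 2 * |Real.sin (Real.pi * (a - b))| := by
    have h2 : circleMap 0 1 (2 * Real.pi * a) - circleMap 0 1 (2 * Real.pi * b)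
        = circleMap 0 1 (2 * Real.pi * b)
          * (Complex.exp (Complex.I * ((2 * Real.pi * (a - b) : ℝ) : ℂ)) - 1) := by
      simp only [circleMap, Complex.ofReal_one, one_mul, zero_add, mul_sub, ← Complex.exp_add,
        mul_one]
      congr 2
      push_cast; ring
    rw [h2, norm_mul, Complex.norm_exp_I_mul_ofReal_sub_one, norm_circleMap_zero]
    simp only [abs_one, one_mul, norm_mul, Real.norm_eq_abs, abs_two]
    congr 3; ring
  have h3 := Real.mul_abs_le_abs_sin (x := Real.pi * (a - b)) (by
    rw [abs_mul, abs_of_pos Real.pi_pos]; nlinarith [Real.pi_pos])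
  rw [abs_mul, abs_of_pos Real.pi_pos, ← mul_assoc, div_mul_cancel₀ _ Real.pi_ne_zero] at h3
  rw [h1]
  nlinarith [abs_nonneg (a - b)]

theorem volume_preimage_expTorus_eq_zero {n : ℕ} {E : Set (EuclideanSpace ℂ (Fin n))}
    (hE : μH[(n : ℝ)] E = 0) : volume (expTorus ⁻¹' E) = 0 := by
  refine measure_null_of_locally_null _ fun x _ => ?_
  refine ⟨Metric.ball x (1 / 4) ∩ expTorus ⁻¹' E,
    inter_mem (mem_nhdsWithin_of_mem_nhds (Metric.ball_mem_nhds x (by norm_num)))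
      self_mem_nhdsWithin, ?_⟩
  let g : Metric.ball x (1 / 4) → EuclideanSpace ℂ (Fin n) := fun θ => expTorus θ.1
  have hg : AntilipschitzWith 1 g := by
    refine AntilipschitzWith.of_le_mul_dist fun a b => ?_
    rw [NNReal.coe_one, one_mul, Subtype.dist_eq, dist_pi_le_iff dist_nonneg]
    intro j
    have hab : |a.1 j - b.1 j| ≤ 1 / 2 := by
      have h1 := (dist_le_pi_dist a.1 b.1 j).trans (dist_triangle_right _ _ x)
      rw [Real.dist_eq] at h1
      have h2 := Metric.mem_ball.1 a.2
      have h3 := Metric.mem_ball.1 b.2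
      linarith
    rw [Real.dist_eq]
    refine (norm_sub_le_norm_circleMap_sub hab).trans ?_
    rw [dist_eq_norm]
    exact PiLp.norm_apply_le (g a - g b) j
  have h0 := hg.hausdorffMeasure_preimage_le (d := (n : ℝ)) n.cast_nonneg E
  rw [hE, mul_zero, nonpos_iff_eq_zero] at h0
  have h1 := (isometry_subtype_coe (s := Metric.ball x (1 / 4))).hausdorffMeasure_image
    (d := (n : ℝ)) (Or.inl n.cast_nonneg) (g ⁻¹' E)
  rw [h0] at h1
  have h2 : Subtype.val '' (g ⁻¹' E) = Metric.ball x (1 / 4) ∩ expTorus ⁻¹' E := by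
    ext θ; simp [g, and_comm]
  rw [h2] at h1
  have := hausdorffMeasure_pi_real (ι := Fin n)
  rw [Fintype.card_fin] at this
  rwa [this] at h1

theorem polyPoisson_nonneg {n : ℕ} {z : EuclideanSpace ℂ (Fin n)} (hz : z ∈ polydisc n)
    (ζ : EuclideanSpace ℂ (Fin n)) : 0 ≤ polyPoisson z ζ := by
  refine Finset.prod_nonneg fun j _ => div_nonneg ?_ (by positivity)
  nlinarith [hz j, norm_nonneg (z j)]

theorem polyPoisson_smul_comm {n : ℕ} {ζ η : EuclideanSpace ℂ (Fin n)} (hζ : ζ ∈ torus (Fin n))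
    (hη : η ∈ torus (Fin n)) (s : ℝ) :
    polyPoisson ((s : ℂ) • ζ) η = polyPoisson ((s : ℂ) • η) ζ := by
  unfold polyPoisson
  refine Finset.prod_congr rfl fun j _ => ?_
  have h1 : ‖ζ j‖ ^ 2 = 1 := by rw [hζ j, one_pow]
  have h2 : ‖η j‖ ^ 2 = 1 := by rw [hη j, one_pow]
  simp only [PiLp.smul_apply, norm_smul, hζ j, hη j]
  congr 1
  rw [Complex.sq_norm, Complex.normSq_apply] at h1 h2 ⊢
  rw [Complex.sq_norm, Complex.normSq_apply]
  simp only [smul_eq_mul, Complex.sub_re, Complex.sub_im, Complex.re_ofReal_mul,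
    Complex.im_ofReal_mul]
  linear_combination (1 - s ^ 2) * (h2 - h1)

theorem polyPoisson_le {n : ℕ} {ζ η : EuclideanSpace ℂ (Fin n)} (hζ : ζ ∈ torus (Fin n))
    (hη : η ∈ torus (Fin n)) {s : ℝ} (hs₀ : 0 ≤ s) (hs₁ : s < 1) :
    polyPoisson ((s : ℂ) • η) ζ ≤ (1 / (1 - s) ^ 2) ^ n := by
  have hn : ∀ j, ‖((s : ℂ) • η) j‖ = s := fun j => by
    simp [hη j, abs_of_nonneg hs₀]
  have : (1 / (1 - s) ^ 2) ^ n = ∏ _j : Fin n, (1 / (1 - s) ^ 2) := by simp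
  rw [this]
  refine Finset.prod_le_prod (fun j _ => ?_) fun j _ => ?_
  · rw [hn]
    exact div_nonneg (by nlinarith) (by positivity)
  · have h1 : 1 - s ≤ ‖ζ j - ((s : ℂ) • η) j‖ := by
      have := norm_sub_norm_le (ζ j) (((s : ℂ) • η) j)
      rwa [hn, hζ j] at this
    have h2 : 0 < 1 - s := sub_pos.2 hs₁
    rw [hn]
    gcongr
    nlinarith

theorem measurable_polyPoisson {n : ℕ} :
    Measurable fun x : EuclideanSpace ℂ (Fin n) × EuclideanSpace ℂ (Fin n) =>
      polyPoisson x.1 x.2 := by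
  unfold polyPoisson
  refine Finset.measurable_prod _ fun j _ => Measurable.div ?_ ?_
  · exact Continuous.measurable (by fun_prop)
  · exact Continuous.measurable (by fun_prop)

theorem measurable_polyPoisson_smul_expTorus {n : ℕ} (s : ℂ) :
    Measurable fun x : EuclideanSpace ℂ (Fin n) × (Fin n → ℝ) =>
      polyPoisson (s • expTorus x.2) x.1 := by
  have h1 : Measurable fun θ : Fin n → ℝ => s • expTorus θ :=
    Continuous.measurable (by fun_prop)
  have h2 : Measurable fun x : EuclideanSpace ℂ (Fin n) × (Fin n → ℝ) =>
      (s • expTorus x.2, x.1) := (h1.comp measurable_snd).prodMk measurable_fst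
  have h3 := measurable_polyPoisson.comp h2
  exact h3

/-- The density `(1 - |φ|²) / |α - φ|²`, whose Poisson representing measure is the Clark measure. -/
def clarkDensity {n : ℕ} (φ : EuclideanSpace ℂ (Fin n) → ℂ) (α : ℂ)
    (z : EuclideanSpace ℂ (Fin n)) : ℝ :=
  (1 - ‖φ z‖ ^ 2) / ‖α - φ z‖ ^ 2

namespace IsClarkMeasure

variable {n : ℕ} {φ : EuclideanSpace ℂ (Fin n) → ℂ} {α : ℂ}
  {μ : Measure (EuclideanSpace ℂ (Fin n))}

theorem ae_mem_torus (hμ : IsClarkMeasure n φ α μ) : ∀ᵐ ζ ∂μ, ζ ∈ torus (Fin n) :=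
  hμ.2.1

theorem integral_polyPoisson (hμ : IsClarkMeasure n φ α μ) {z : EuclideanSpace ℂ (Fin n)}
    (hz : z ∈ polydisc n) (hφ : ‖φ z‖ < 1) :
    ∫ ζ, polyPoisson z ζ ∂μ = clarkDensity φ α z := by
  rw [integral_eq_lintegral_of_nonneg_ae (ae_of_all _ (polyPoisson_nonneg hz))
    (measurable_polyPoisson.comp measurable_prodMk_left).aestronglyMeasurable]
  unfold polyPoisson
  rw [hμ.2.2 z hz, ENNReal.toReal_ofReal]
  · rfl
  · exact div_nonneg (by nlinarith [norm_nonneg (φ z)]) (by positivity)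

theorem integral_pEval_smul (hμ : IsClarkMeasure n φ α μ)
    (hφ : ∀ z ∈ polydisc n, ‖φ z‖ < 1) (f : MvPolynomial (Fin n) ℂ) {s : ℝ}
    (hs₀ : 0 ≤ s) (hs₁ : s < 1) :
    ∫ ζ, pEval f ((s : ℂ) • ζ) ∂μ =
      ∫ θ, (clarkDensity φ α ((s : ℂ) • expTorus θ) : ℂ) * pEval f (expTorus θ)
        ∂cubeMeasure n := by
  have := hμ.1
  have hdisc : ∀ {ζ : EuclideanSpace ℂ (Fin n)}, ζ ∈ torus (Fin n) → (s : ℂ) • ζ ∈ polydisc n :=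
    fun hζ => smul_mem_polydisc hs₀ hs₁ (torus_subset_closedPolydisc n hζ)
  let F : EuclideanSpace ℂ (Fin n) → (Fin n → ℝ) → ℂ := fun ζ θ =>
    (polyPoisson ((s : ℂ) • expTorus θ) ζ : ℂ) * pEval f (expTorus θ)
  have h1 : ∫ ζ, pEval f ((s : ℂ) • ζ) ∂μ = ∫ ζ, ∫ θ, F ζ θ ∂cubeMeasure n ∂μ := by
    refine integral_congr_ae ?_
    filter_upwards [hμ.ae_mem_torus] with ζ hζ
    rw [← integral_polyPoisson_mul_pEval (hdisc hζ)]
    refine integral_congr_ae (ae_of_all _ fun θ => ?_)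
    simp only [F]
    rw [polyPoisson_smul_comm hζ (expTorus_mem θ)]
  have h_int : Integrable (Function.uncurry F) (μ.prod (cubeMeasure n)) := by
    obtain ⟨C, hC⟩ := (isCompact_torus n).exists_bound_of_continuousOn
      (continuous_pEval f).continuousOn
    refine Integrable.of_bound (C := (1 / (1 - s) ^ 2) ^ n * C) ?_ ?_
    · have h2 : Measurable fun θ : Fin n → ℝ => pEval f (expTorus θ) :=
        Continuous.measurable (by fun_prop)
      exact ((Complex.measurable_ofReal.comp (measurable_polyPoisson_smul_expTorus s)).mul
        (h2.comp measurable_snd)).aestronglyMeasurable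
    · filter_upwards [Measure.quasiMeasurePreserving_fst.ae hμ.ae_mem_torus] with x hx
      simp only [Function.uncurry, F, norm_mul, Complex.norm_real, Real.norm_eq_abs]
      rw [abs_of_nonneg (polyPoisson_nonneg (hdisc (expTorus_mem _)) _)]
      gcongr
      · exact polyPoisson_le hx (expTorus_mem _) hs₀ hs₁
      · exact hC _ (expTorus_mem _)
  rw [h1, integral_integral_swap h_int]
  refine integral_congr_ae (ae_of_all _ fun θ => ?_)
  have hz := hdisc (expTorus_mem θ)
  simp only [F]
  rw [integral_mul_const, integral_complex_ofReal, hμ.integral_polyPoisson hz (hφ _ hz)]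

end IsClarkMeasure

namespace IsRationalInner

variable {n : ℕ} {P q : MvPolynomial (Fin n) ℂ} {φ : EuclideanSpace ℂ (Fin n) → ℂ}

theorem continuousOn_dilate (hφ : IsRationalInner n P q φ) {r : ℝ} (hr₀ : 0 ≤ r) (hr₁ : r < 1) :
    ContinuousOn (fun z => φ ((r : ℂ) • z)) (closedPolydisc n) := by
  have h : ContinuousOn (fun z => pEval P ((r : ℂ) • z) / pEval q ((r : ℂ) • z))
      (closedPolydisc n) := by
    refine ContinuousOn.div (by fun_prop) (by fun_prop) fun z hz => ?_
    exact hφ.q_ne_zero _ (smul_mem_polydisc hr₀ hr₁ hz)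
  exact h.congr fun z hz => hφ.phi_eq _ (smul_mem_polydisc hr₀ hr₁ hz)

theorem continuous_dilate_expTorus (hφ : IsRationalInner n P q φ) {r : ℝ} (hr₀ : 0 ≤ r)
    (hr₁ : r < 1) : Continuous fun θ : Fin n → ℝ => φ ((r : ℂ) • expTorus θ) :=
  (hφ.continuousOn_dilate hr₀ hr₁).comp_continuous continuous_expTorus
    fun θ => torus_subset_closedPolydisc n (expTorus_mem θ)

theorem ae_radial_limit (hφ : IsRationalInner n P q φ) :
    ∀ᵐ θ ∂cubeMeasure n, ∃ β : ℂ, ‖β‖ = 1 ∧ HasRadialLimit φ (expTorus θ) β := by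
  obtain ⟨E, -, hE, h⟩ := hφ.inner
  rw [cubeMeasure_eq]
  refine ae_restrict_of_ae ?_
  filter_upwards [measure_eq_zero_iff_ae_notMem.1 (volume_preimage_expTorus_eq_zero hE)] with θ hθ
  exact h _ ⟨expTorus_mem θ, hθ⟩

theorem tendsto_integral_one_sub_norm_sq (hφ : IsRationalInner n P q φ) :
    Tendsto (fun s : ℝ => ∫ θ, (1 - ‖φ ((s : ℂ) • expTorus θ)‖ ^ 2) ∂cubeMeasure n)
      (nhdsWithin 1 (Iio 1)) (nhds 0) := by
  have hs : ∀ᶠ s : ℝ in nhdsWithin 1 (Iio 1), 0 ≤ s ∧ s < 1 := by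
    filter_upwards [Ioo_mem_nhdsLT (zero_lt_one' ℝ)] with s hs
    exact ⟨hs.1.le, hs.2⟩
  have h0 : (0 : ℝ) = ∫ _θ : Fin n → ℝ, (0 : ℝ) ∂cubeMeasure n := by simp
  rw [h0]
  refine tendsto_integral_filter_of_dominated_convergence (fun _ => 1) ?_ ?_
    (integrable_const _) ?_
  · filter_upwards [hs] with s hs
    have := hφ.continuous_dilate_expTorus hs.1 hs.2
    exact (continuous_const.sub (this.norm.pow 2)).aestronglyMeasurable
  · filter_upwards [hs] with s hs
    refine ae_of_all _ fun θ => ?_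
    have := hφ.abs_lt_one _ (smul_mem_polydisc hs.1 hs.2
      (torus_subset_closedPolydisc n (expTorus_mem θ)))
    rw [Real.norm_eq_abs, abs_le]
    constructor <;> nlinarith [norm_nonneg (φ ((s : ℂ) • expTorus θ))]
  · filter_upwards [hφ.ae_radial_limit] with θ ⟨β, hβ, hlim⟩
    have h1 := (hlim.norm.pow 2).const_sub 1
    rwa [hβ, one_pow, sub_self] at h1

end IsRationalInner

namespace IsClarkMeasure

variable {n : ℕ} {P q : MvPolynomial (Fin n) ℂ} {φ : EuclideanSpace ℂ (Fin n) → ℂ} {α : ℂ}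
  {μ : Measure (EuclideanSpace ℂ (Fin n))}

theorem integrable_of_continuousOn (hμ : IsClarkMeasure n φ α μ)
    {E : Type*} [NormedAddCommGroup E] {g : EuclideanSpace ℂ (Fin n) → E}
    (hg : ContinuousOn g (torus (Fin n))) : Integrable g μ := by
  have := hμ.1
  rw [← Measure.restrict_eq_self_of_ae_mem hμ.ae_mem_torus]
  exact hg.integrableOn_compact (isCompact_torus n)

theorem integral_clarkDensity (hμ : IsClarkMeasure n φ α μ)
    (hφ : ∀ z ∈ polydisc n, ‖φ z‖ < 1) {s : ℝ} (hs₀ : 0 ≤ s) (hs₁ : s < 1) :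
    ∫ θ, clarkDensity φ α ((s : ℂ) • expTorus θ) ∂cubeMeasure n = μ.real univ := by
  have h := hμ.integral_pEval_smul hφ 1 hs₀ hs₁
  simp only [pEval, map_one, mul_one, integral_complex_ofReal, integral_const] at h
  simpa using (Complex.ofReal_injective (by simpa using h)).symm

theorem clarkDensity_nonneg {z : EuclideanSpace ℂ (Fin n)} (hz : ‖φ z‖ < 1) :
    0 ≤ clarkDensity φ α z :=
  div_nonneg (by nlinarith [norm_nonneg (φ z)]) (by positivity)

theorem continuous_clarkDensity (hφ : IsRationalInner n P q φ) (hα : ‖α‖ = 1) {s : ℝ}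
    (hs₀ : 0 ≤ s) (hs₁ : s < 1) :
    Continuous fun θ : Fin n → ℝ => clarkDensity φ α ((s : ℂ) • expTorus θ) := by
  have h := hφ.continuous_dilate_expTorus hs₀ hs₁
  refine (continuous_const.sub (h.norm.pow 2)).div ((continuous_const.sub h).norm.pow 2) fun θ => ?_
  refine pow_ne_zero 2 (norm_ne_zero_iff.2 (ne_of_norm_lt_one hα ?_))
  exact hφ.abs_lt_one _ (smul_mem_polydisc hs₀ hs₁
    (torus_subset_closedPolydisc n (expTorus_mem θ)))

theorem integral_dilate (hμ : IsClarkMeasure n φ α μ) (hφ : IsRationalInner n P q φ)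
    (hα : ‖α‖ = 1) {s : ℝ} (hs₀ : 0 ≤ s) (hs₁ : s < 1) :
    ∫ ζ, φ ((s : ℂ) • (s : ℂ) • ζ) ∂μ =
      ∫ θ, (clarkDensity φ α ((s : ℂ) • expTorus θ) : ℂ) * φ ((s : ℂ) • expTorus θ)
        ∂cubeMeasure n := by
  have := hμ.1
  have hmem : ∀ {ζ : EuclideanSpace ℂ (Fin n)}, ζ ∈ torus (Fin n) →
      (s : ℂ) • ζ ∈ polydisc n := fun hζ =>
    smul_mem_polydisc hs₀ hs₁ (torus_subset_closedPolydisc n hζ)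
  have hmaps : MapsTo (fun ζ : EuclideanSpace ℂ (Fin n) => (s : ℂ) • ζ) (torus (Fin n))
      (closedPolydisc n) := fun ζ hζ j => (hmem hζ j).le
  have hW := continuous_clarkDensity hφ hα hs₀ hs₁
  have hφs := hφ.continuous_dilate_expTorus hs₀ hs₁
  have hWφ : Continuous fun θ =>
      (clarkDensity φ α ((s : ℂ) • expTorus θ) : ℂ) * φ ((s : ℂ) • expTorus θ) :=
    (Complex.continuous_ofReal.comp hW).mul hφs
  have h_int : Integrable (fun ζ => φ ((s : ℂ) • (s : ℂ) • ζ)) μ :=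
    hμ.integrable_of_continuousOn ((hφ.continuousOn_dilate hs₀ hs₁).comp (by fun_prop) hmaps)
  have key : ∀ ε > 0, ‖∫ ζ, φ ((s : ℂ) • (s : ℂ) • ζ) ∂μ -
      ∫ θ, (clarkDensity φ α ((s : ℂ) • expTorus θ) : ℂ) * φ ((s : ℂ) • expTorus θ)
        ∂cubeMeasure n‖ ≤ ε * (2 * μ.real univ) := by
    intro ε hε
    obtain ⟨f, hf⟩ := exists_pEval_approx_div P q hφ.q_ne_zero hs₀ hs₁ hε
    have hf' : ∀ z ∈ closedPolydisc n, ‖pEval f z - φ ((s : ℂ) • z)‖ ≤ ε := fun z hz => by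
      rw [hφ.phi_eq _ (smul_mem_polydisc hs₀ hs₁ hz)]
      exact (hf z hz).le
    have h1 : ‖∫ ζ, pEval f ((s : ℂ) • ζ) ∂μ - ∫ ζ, φ ((s : ℂ) • (s : ℂ) • ζ) ∂μ‖
        ≤ ε * μ.real univ := by
      rw [← integral_sub (hμ.integrable_of_continuousOn (by fun_prop)) h_int]
      refine norm_integral_le_of_norm_le_const ?_
      filter_upwards [hμ.ae_mem_torus] with ζ hζ
      exact hf' _ (hmaps hζ)
    have h2 : ‖∫ θ, (clarkDensity φ α ((s : ℂ) • expTorus θ) : ℂ) * pEval f (expTorus θ)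
        ∂cubeMeasure n - ∫ θ, (clarkDensity φ α ((s : ℂ) • expTorus θ) : ℂ)
          * φ ((s : ℂ) • expTorus θ) ∂cubeMeasure n‖ ≤ ε * μ.real univ := by
      rw [← integral_sub (Continuous.integrable_cubeMeasure (by fun_prop))
        (Continuous.integrable_cubeMeasure hWφ),
        ← hμ.integral_clarkDensity hφ.abs_lt_one hs₀ hs₁, ← integral_const_mul]
      refine norm_integral_le_of_norm_le (Continuous.integrable_cubeMeasure (by fun_prop))
        (ae_of_all _ fun θ => ?_)
      have hW0 := clarkDensity_nonneg (α := α) (hφ.abs_lt_one _ (hmem (expTorus_mem θ)))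
      rw [← mul_sub, norm_mul, Complex.norm_real, Real.norm_eq_abs, abs_of_nonneg hW0, mul_comm]
      exact mul_le_mul_of_nonneg_right
        (hf' _ (torus_subset_closedPolydisc n (expTorus_mem θ))) hW0
    rw [← hμ.integral_pEval_smul hφ.abs_lt_one f hs₀ hs₁] at h2
    have h3 := norm_sub_le_norm_sub_add_norm_sub (∫ ζ, φ ((s : ℂ) • (s : ℂ) • ζ) ∂μ)
      (∫ ζ, pEval f ((s : ℂ) • ζ) ∂μ)
      (∫ θ, (clarkDensity φ α ((s : ℂ) • expTorus θ) : ℂ) * φ ((s : ℂ) • expTorus θ)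
        ∂cubeMeasure n)
    rw [norm_sub_rev] at h1
    linarith
  refine sub_eq_zero.1 (norm_le_zero_iff.1 ?_)
  have hlim : Tendsto (fun ε : ℝ => ε * (2 * μ.real univ)) (nhdsWithin 0 (Ioi 0)) (nhds 0) := by
    have : Tendsto (fun ε : ℝ => ε * (2 * μ.real univ)) (nhds 0) (nhds (0 * (2 * μ.real univ))) :=
      tendsto_id.mul_const _
    rw [zero_mul] at this
    exact this.mono_left nhdsWithin_le_nhds
  exact ge_of_tendsto hlim (by filter_upwards [self_mem_nhdsWithin] with ε hε using key ε hε)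

theorem integral_norm_sub_sq_le (hμ : IsClarkMeasure n φ α μ) (hφ : IsRationalInner n P q φ)
    (hα : ‖α‖ = 1) {s : ℝ} (hs₀ : 0 ≤ s) (hs₁ : s < 1) {δ : ℝ} (hδ : 0 < δ) :
    ∫ ζ, ‖α - φ ((s : ℂ) • (s : ℂ) • ζ)‖ ^ 2 ∂μ ≤
      2 * (δ * μ.real univ
        + δ⁻¹ * ∫ θ, (1 - ‖φ ((s : ℂ) • expTorus θ)‖ ^ 2) ∂cubeMeasure n) := by
  have := hμ.1
  have hmem : ∀ {ζ : EuclideanSpace ℂ (Fin n)}, ζ ∈ torus (Fin n) →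
      (s : ℂ) • ζ ∈ polydisc n := fun hζ =>
    smul_mem_polydisc hs₀ hs₁ (torus_subset_closedPolydisc n hζ)
  have hmaps : MapsTo (fun ζ : EuclideanSpace ℂ (Fin n) => (s : ℂ) • ζ) (torus (Fin n))
      (closedPolydisc n) := fun ζ hζ j => (hmem hζ j).le
  have hW := continuous_clarkDensity hφ hα hs₀ hs₁
  have hφs := hφ.continuous_dilate_expTorus hs₀ hs₁
  have hWφ : Continuous fun θ =>
      (clarkDensity φ α ((s : ℂ) • expTorus θ) : ℂ) * φ ((s : ℂ) • expTorus θ) :=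
    (Complex.continuous_ofReal.comp hW).mul hφs
  have hφ2 : Continuous fun θ => δ⁻¹ * (1 - ‖φ ((s : ℂ) • expTorus θ)‖ ^ 2) :=
    continuous_const.mul (continuous_const.sub (hφs.norm.pow 2))
  have hcont : ContinuousOn (fun ζ => φ ((s : ℂ) • (s : ℂ) • ζ)) (torus (Fin n)) :=
    (hφ.continuousOn_dilate hs₀ hs₁).comp (by fun_prop) hmaps
  have h_int := hμ.integrable_of_continuousOn hcont
  have hαα : (starRingEnd ℂ) α * α = 1 := by
    rw [mul_comm, Complex.mul_conj, Complex.normSq_eq_norm_sq, hα]; norm_num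
  have hsq : ∀ w : ℂ, ‖α - w‖ = ‖1 - (starRingEnd ℂ) α * w‖ := fun w => by
    rw [← hαα, ← mul_sub, norm_mul, RCLike.norm_conj, hα, one_mul]
  let G : ℂ → ℂ := fun w => 1 - (starRingEnd ℂ) α * w
  have hG : Continuous G := by fun_prop
  have h1 : ∫ ζ, ‖α - φ ((s : ℂ) • (s : ℂ) • ζ)‖ ^ 2 ∂μ
      ≤ ∫ ζ, 2 * (G (φ ((s : ℂ) • (s : ℂ) • ζ))).re ∂μ := by
    refine integral_mono_ae
      (hμ.integrable_of_continuousOn ((continuousOn_const.sub hcont).norm.pow 2))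
      (hμ.integrable_of_continuousOn ?_) ?_
    · exact continuousOn_const.mul (Complex.continuous_re.comp_continuousOn
        (hG.comp_continuousOn hcont))
    · filter_upwards [hμ.ae_mem_torus] with ζ hζ
      have hlt : ‖(starRingEnd ℂ) α * φ ((s : ℂ) • (s : ℂ) • ζ)‖ < 1 := by
        rw [norm_mul, RCLike.norm_conj, hα, one_mul]
        exact hφ.abs_lt_one _ (smul_mem_polydisc hs₀ hs₁ (hmaps hζ))
      rw [hsq]
      simp only [G]
      generalize (starRingEnd ℂ) α * φ ((s : ℂ) • (s : ℂ) • ζ) = u at hlt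
      have hu : ‖u‖ ^ 2 ≤ 1 := by nlinarith [norm_nonneg u]
      rw [Complex.sq_norm, Complex.normSq_apply] at hu ⊢
      simp only [Complex.sub_re, Complex.sub_im, Complex.one_re, Complex.one_im]
      nlinarith
  have h2 : ∫ ζ, G (φ ((s : ℂ) • (s : ℂ) • ζ)) ∂μ
      = ∫ θ, (clarkDensity φ α ((s : ℂ) • expTorus θ) : ℂ) * G (φ ((s : ℂ) • expTorus θ))
        ∂cubeMeasure n := by
    have hr : ∀ θ : Fin n → ℝ,
        (clarkDensity φ α ((s : ℂ) • expTorus θ) : ℂ) * G (φ ((s : ℂ) • expTorus θ))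
        = (clarkDensity φ α ((s : ℂ) • expTorus θ) : ℂ) - (starRingEnd ℂ) α *
          ((clarkDensity φ α ((s : ℂ) • expTorus θ) : ℂ) * φ ((s : ℂ) • expTorus θ)) :=
      fun θ => by simp only [G]; ring
    simp_rw [hr]
    rw [integral_sub (Continuous.integrable_cubeMeasure (by fun_prop))
      ((Continuous.integrable_cubeMeasure hWφ).const_mul _), integral_const_mul,
      ← hμ.integral_dilate hφ hα hs₀ hs₁, integral_complex_ofReal,
      hμ.integral_clarkDensity hφ.abs_lt_one hs₀ hs₁]
    simp only [G]
    rw [integral_sub (integrable_const _) (h_int.const_mul _), integral_const_mul]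
    simp
  have h3 : ∫ ζ, 2 * (G (φ ((s : ℂ) • (s : ℂ) • ζ))).re ∂μ
      = 2 * (∫ ζ, G (φ ((s : ℂ) • (s : ℂ) • ζ)) ∂μ).re := by
    rw [integral_const_mul]
    congr 1
    exact integral_re (hμ.integrable_of_continuousOn (hG.comp_continuousOn hcont))
  rw [h3, h2] at h1
  refine h1.trans (mul_le_mul_of_nonneg_left ?_ zero_le_two)
  refine (Complex.re_le_norm _).trans ?_
  rw [← hμ.integral_clarkDensity hφ.abs_lt_one hs₀ hs₁, ← integral_const_mul,
    ← integral_const_mul, ← integral_add (Continuous.integrable_cubeMeasure (by fun_prop))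
      (Continuous.integrable_cubeMeasure hφ2)]
  refine norm_integral_le_of_norm_le (Continuous.integrable_cubeMeasure
    ((continuous_const.mul hW).add hφ2))
    (ae_of_all _ fun θ => ?_)
  have hlt := hφ.abs_lt_one _ (hmem (expTorus_mem θ))
  have hW0 := clarkDensity_nonneg (α := α) hlt
  rw [norm_mul, Complex.norm_real, Real.norm_eq_abs, abs_of_nonneg hW0, ← hsq]
  have hx : 0 < ‖α - φ ((s : ℂ) • expTorus θ)‖ := norm_pos_iff.2 (ne_of_norm_lt_one hα hlt)
  have hy : 0 ≤ 1 - ‖φ ((s : ℂ) • expTorus θ)‖ ^ 2 := by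
    nlinarith [norm_nonneg (φ ((s : ℂ) • expTorus θ))]
  simp only [clarkDensity]
  generalize ‖α - φ ((s : ℂ) • expTorus θ)‖ = x at hx
  generalize 1 - ‖φ ((s : ℂ) • expTorus θ)‖ ^ 2 = y at hy
  have : δ * (y / x ^ 2) + δ⁻¹ * y - y / x ^ 2 * x
      = y * δ⁻¹ * ((δ / x - 1) ^ 2 + δ / x) := by
    field_simp; ring
  have h5 : 0 ≤ y * δ⁻¹ * ((δ / x - 1) ^ 2 + δ / x) := by positivity
  linarith

theorem exists_integral_norm_sub_sq_le (hμ : IsClarkMeasure n φ α μ)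
    (hφ : IsRationalInner n P q φ) (hα : ‖α‖ = 1) {ε : ℝ} (hε : 0 < ε) :
    ∃ r : ℝ, 0 ≤ r ∧ r < 1 ∧ ∫ ζ, ‖α - φ ((r : ℂ) • ζ)‖ ^ 2 ∂μ ≤ ε := by
  have hM : 0 ≤ μ.real univ := measureReal_nonneg
  let δ : ℝ := ε / (4 * (μ.real univ + 1))
  have hδ : 0 < δ := by positivity
  have hδM : δ * μ.real univ ≤ ε / 4 := by
    have : δ * (4 * (μ.real univ + 1)) = ε := div_mul_cancel₀ _ (by positivity)
    nlinarith
  have h := hφ.tendsto_integral_one_sub_norm_sq.eventually_lt_const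
    (show 0 < δ * (ε / 4) by positivity)
  obtain ⟨s, hs, hs₀, hs₁⟩ := (h.and (Ioo_mem_nhdsLT (zero_lt_one' ℝ))).exists
  refine ⟨s * s, by positivity, by nlinarith, ?_⟩
  have h1 := hμ.integral_norm_sub_sq_le hφ hα hs₀.le hs₁ hδ
  have h2 : δ⁻¹ * ∫ θ, (1 - ‖φ ((s : ℂ) • expTorus θ)‖ ^ 2) ∂cubeMeasure n ≤ ε / 4 := by
    rw [inv_mul_le_iff₀ hδ]; exact hs.le
  simp_rw [smul_smul] at h1
  push_cast
  linarith

end IsClarkMeasure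

section Density

variable {X : Type*} [TopologicalSpace X] [CompactSpace X] [MeasurableSpace X] [BorelSpace X]
  {ν : Measure X} [IsFiniteMeasure ν]

theorem ContinuousMap.norm_toLp_mul_le (g h : C(X, ℂ)) :
    ‖ContinuousMap.toLp 2 ν ℂ (g * h)‖ ≤ ‖g‖ * ‖ContinuousMap.toLp 2 ν ℂ h‖ := by
  refine Lp.norm_le_mul_norm_of_ae_le_mul ?_
  filter_upwards [ContinuousMap.coeFn_toLp (p := 2) (𝕜 := ℂ) ν (g * h),
    ContinuousMap.coeFn_toLp (p := 2) (𝕜 := ℂ) ν h] with x h₁ h₂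
  rw [h₁, h₂, ContinuousMap.mul_apply, norm_mul]
  exact mul_le_mul_of_nonneg_right (g.norm_coe_le_norm x) (norm_nonneg _)

theorem ContinuousMap.toLp_mul_mem_closure {A : Set C(X, ℂ)} {g : C(X, ℂ)}
    (hg : ∀ f ∈ A, toLp 2 ν ℂ (g * f) ∈ closure (toLp 2 ν ℂ '' A)) {h : C(X, ℂ)}
    (hh : toLp 2 ν ℂ h ∈ closure (toLp 2 ν ℂ '' A)) :
    toLp 2 ν ℂ (g * h) ∈ closure (toLp 2 ν ℂ '' A) := by
  rw [← closure_closure, Metric.mem_closure_iff]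
  intro ε hε
  obtain ⟨-, ⟨f, hf, rfl⟩, hfh⟩ := Metric.mem_closure_iff.1 hh (ε / (‖g‖ + 1)) (by positivity)
  refine ⟨_, hg f hf, ?_⟩
  rw [lt_div_iff₀ (by positivity), dist_eq_norm, ← map_sub] at hfh
  rw [dist_eq_norm, ← map_sub, ← mul_sub]
  refine (norm_toLp_mul_le g (h - f)).trans_lt (lt_of_le_of_lt ?_ hfh)
  rw [mul_comm]
  exact mul_le_mul_of_nonneg_left (by linarith) (norm_nonneg _)

theorem ContinuousMap.dense_toLp_image_adjoin [ν.WeaklyRegular] [NormalSpace X]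
    {s : Set C(X, ℂ)} (hs : (StarAlgebra.adjoin ℂ s).SeparatesPoints)
    (hstar : ∀ g ∈ s, ∀ f ∈ Algebra.adjoin ℂ s,
      toLp 2 ν ℂ (star g * f) ∈ closure (toLp 2 ν ℂ '' (Algebra.adjoin ℂ s : Set C(X, ℂ)))) :
    Dense (toLp 2 ν ℂ '' (Algebra.adjoin ℂ s : Set C(X, ℂ))) := by
  set A := Algebra.adjoin ℂ s
  let H : Submodule ℂ (Lp ℂ 2 ν) :=
    (A.toSubmodule.map (toLp 2 ν ℂ : C(X, ℂ) →L[ℂ] Lp ℂ 2 ν).toLinearMap).topologicalClosure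
  have hA : ∀ g ∈ A, ∀ f ∈ A,
      toLp 2 ν ℂ (g * f) ∈ closure (toLp 2 ν ℂ '' (A : Set C(X, ℂ))) := fun g hg f hf =>
    subset_closure ⟨_, A.mul_mem hg hf, rfl⟩
  let M : Subalgebra ℂ C(X, ℂ) :=
    { carrier := {g | ∀ h, toLp 2 ν ℂ h ∈ H → toLp 2 ν ℂ (g * h) ∈ H}
      mul_mem' := fun {a b} ha hb h hh => by rw [mul_assoc]; exact ha _ (hb _ hh)
      add_mem' := fun {a b} ha hb h hh => by
        rw [add_mul, map_add]; exact H.add_mem (ha _ hh) (hb _ hh)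
      algebraMap_mem' := fun c h hh => by
        rw [← Algebra.smul_def, map_smul]; exact H.smul_mem _ hh }
  have hM : Algebra.adjoin ℂ (s ∪ star s) ≤ M := by
    refine Algebra.adjoin_le (union_subset (fun g hg h hh => ?_) fun g hg h hh => ?_)
    · exact toLp_mul_mem_closure (hA g (Algebra.subset_adjoin hg)) hh
    · have := hstar _ hg
      rw [star_star] at this
      exact toLp_mul_mem_closure this hh
  have h1 : toLp 2 ν ℂ (1 : C(X, ℂ)) ∈ H := subset_closure ⟨1, A.one_mem, rfl⟩
  have hd : Dense (StarAlgebra.adjoin ℂ s : Set C(X, ℂ)) := by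
    have := starSubalgebra_topologicalClosure_eq_top_of_separatesPoints _ hs
    rw [dense_iff_closure_eq, ← StarSubalgebra.topologicalClosure_coe, this]; rfl
  have hdd := (toLp_denseRange ℂ ν (𝕜 := ℂ) (p := 2) (by simp)).dense_image
    (toLp 2 ν ℂ : C(X, ℂ) →L[ℂ] Lp ℂ 2 ν).continuous hd
  rw [dense_iff_closure_eq, ← univ_subset_iff, ← hdd.closure_eq]
  refine closure_minimal ?_ isClosed_closure
  rintro - ⟨g, hg, rfl⟩
  have := hM hg 1 h1
  rwa [mul_one] at this

end Density

instance (n : ℕ) : CompactSpace (torus (Fin n)) :=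
  isCompact_iff_compactSpace.1 (isCompact_torus n)

/-- A measure on `ℂⁿ`, seen as a measure on the torus. -/
def torusMeasure {n : ℕ} (μ : Measure (EuclideanSpace ℂ (Fin n))) : Measure (torus (Fin n)) :=
  μ.comap (↑)

instance {n : ℕ} (μ : Measure (EuclideanSpace ℂ (Fin n))) [IsFiniteMeasure μ] :
    IsFiniteMeasure (torusMeasure μ) := by
  refine ⟨?_⟩
  rw [torusMeasure, comap_subtype_coe_apply (isClosed_torus n).measurableSet]
  exact measure_lt_top μ _

namespace IsClarkMeasure

variable {n : ℕ} {P p q : MvPolynomial (Fin n) ℂ} {φ : EuclideanSpace ℂ (Fin n) → ℂ} {α : ℂ}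
  {μ : Measure (EuclideanSpace ℂ (Fin n))}

theorem measurePreserving_subtype_val (hμ : IsClarkMeasure n φ α μ) :
    MeasurePreserving ((↑) : torus (Fin n) → EuclideanSpace ℂ (Fin n)) (torusMeasure μ) μ := by
  refine ⟨measurable_subtype_coe, ?_⟩
  rw [torusMeasure, map_comap_subtype_coe (isClosed_torus n).measurableSet,
    Measure.restrict_eq_self_of_ae_mem hμ.ae_mem_torus]

theorem exists_norm_toLp_sub_le [IsFiniteMeasure μ]
    (hμ : IsClarkMeasure n φ α μ) (hφ : IsRationalInner n P q φ) (hα : ‖α‖ = 1)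
    {ε : ℝ} (hε : 0 < ε) :
    ∃ r : ℝ, 0 ≤ r ∧ r < 1 ∧ ∃ Φ : C(torus (Fin n), ℂ), (∀ ζ, Φ ζ = φ ((r : ℂ) • (ζ : _))) ∧
      ‖ContinuousMap.toLp 2 (torusMeasure μ) ℂ (algebraMap ℂ C(torus (Fin n), ℂ) α - Φ)‖ ≤ ε := by
  obtain ⟨r, hr₀, hr₁, hr⟩ := hμ.exists_integral_norm_sub_sq_le hφ hα (pow_pos hε 2)
  refine ⟨r, hr₀, hr₁, ⟨fun ζ => φ ((r : ℂ) • (ζ : EuclideanSpace ℂ (Fin n))),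
    (hφ.continuousOn_dilate hr₀ hr₁).comp_continuous continuous_subtype_val
      fun ζ => torus_subset_closedPolydisc n ζ.2⟩, fun ζ => rfl, ?_⟩
  refine le_of_sq_le_sq ?_ hε.le
  rw [← Measure.restrict_eq_self_of_ae_mem hμ.ae_mem_torus,
    ← integral_subtype_comap (isClosed_torus n).measurableSet] at hr
  rw [← inner_self_eq_norm_sq (𝕜 := ℂ), ContinuousMap.inner_toLp]
  refine le_of_eq_of_le ?_ hr
  simp_rw [RCLike.mul_conj]
  norm_cast

theorem conj_prod_mul_mem_closure [IsFiniteMeasure μ] (hμ : IsClarkMeasure n φ α μ)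
    (hφ : IsRationalInner n ((∏ j : Fin n, MvPolynomial.X j) * p) q φ) (hα : ‖α‖ = 1)
    (P : MvPolynomial (Fin n) ℂ) :
    ContinuousMap.toLp 2 (torusMeasure μ) ℂ
      (star (polyRestrict (torus (Fin n)) (∏ j, MvPolynomial.X j)) * polyRestrict _ P) ∈
      closure (ContinuousMap.toLp 2 (torusMeasure μ) ℂ ''
        ((polyRestrict (torus (Fin n))).range : Set C(torus (Fin n), ℂ))) := by
  let ρ := polyRestrict (torus (Fin n))
  let L := ContinuousMap.toLp (E := ℂ) 2 (torusMeasure μ) ℂ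
  let c := algebraMap ℂ C(torus (Fin n), ℂ)
  let D := star (ρ (∏ j, MvPolynomial.X j))
  change L (D * ρ P) ∈ _
  rw [Metric.mem_closure_iff]
  intro ε hε
  let C : ℝ := ‖ρ P‖ * (1 + ‖L 1‖) + 1
  have hC : 0 < C := by positivity
  obtain ⟨r, hr₀, hr₁, Φ, hΦ, hΦε⟩ := hμ.exists_norm_toLp_sub_le hφ hα (div_pos hε hC)
  obtain ⟨f, hf⟩ := exists_pEval_approx_div p q hφ.q_ne_zero hr₀ hr₁ (div_pos hε hC)
  let a := c (starRingEnd ℂ α)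
  let F := c ((r : ℂ) ^ n) * ρ f
  have hmem : a * F * ρ P ∈ ρ.range :=
    mul_mem (mul_mem (algebraMap_mem _ _) (mul_mem (algebraMap_mem _ _) ⟨f, rfl⟩)) ⟨P, rfl⟩
  refine ⟨_, mem_image_of_mem _ hmem, ?_⟩
  have haα : a * c α = 1 := by
    rw [← map_mul, mul_comm, Complex.mul_conj, Complex.normSq_eq_norm_sq, hα]; simp
  have hsplit : D * ρ P - a * F * ρ P
      = a * D * ρ P * (c α - Φ) + a * ρ P * (D * Φ - F) * 1 := by
    linear_combination (-D * ρ P) * haα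
  have hD : ∀ ζ : torus (Fin n), D ζ * ∏ j, (ζ : EuclideanSpace ℂ (Fin n)) j = 1 := fun ζ => by
    have h : ρ (∏ j, MvPolynomial.X j) ζ = ∏ j, (ζ : EuclideanSpace ℂ (Fin n)) j := by
      rw [polyRestrict_apply]; simp [pEval]
    rw [ContinuousMap.star_apply, h, Complex.star_def, mul_comm, Complex.mul_conj,
      Complex.normSq_eq_norm_sq, norm_prod, Finset.prod_congr rfl fun j _ => ζ.2 j]
    simp
  have hD₁ : ‖D‖ ≤ 1 := (ContinuousMap.norm_le _ zero_le_one).2 fun ζ => by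
    have h := congrArg norm (hD ζ)
    rw [norm_mul, norm_prod, Finset.prod_congr rfl fun j _ => ζ.2 j] at h
    simpa using h.le
  have ha₁ : ‖a‖ ≤ 1 := (ContinuousMap.norm_le _ zero_le_one).2 fun ζ => by simp [a, c, hα]
  have hDF : ‖D * Φ - F‖ ≤ ε / C := (ContinuousMap.norm_le _ (by positivity)).2 fun ζ => by
    have hζ := torus_subset_closedPolydisc n ζ.2
    have h : (D * Φ - F) ζ = (r : ℂ) ^ n * -(pEval f ζ - pEval p ((r : ℂ) • (ζ : _))
        / pEval q ((r : ℂ) • (ζ : _))) := by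
      have hP (z : EuclideanSpace ℂ (Fin n)) :
          pEval ((∏ j : Fin n, MvPolynomial.X j) * p) ((r : ℂ) • z) =
            (r : ℂ) ^ n * (∏ j, z j) * pEval p ((r : ℂ) • z) := by
        simp [pEval, Finset.prod_mul_distrib]
      have hF : F ζ = (r : ℂ) ^ n * pEval f ζ := by
        rw [← polyRestrict_apply]; simp [F, c, ρ]
      rw [ContinuousMap.sub_apply, ContinuousMap.mul_apply, hF, hΦ,
        hφ.phi_eq _ (smul_mem_polydisc hr₀ hr₁ hζ), hP]
      linear_combination ((r : ℂ) ^ n * pEval p ((r : ℂ) • (ζ : _))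
        / pEval q ((r : ℂ) • (ζ : _))) * hD ζ
    rw [h, norm_mul, norm_neg, norm_pow, Complex.norm_real, Real.norm_eq_abs, abs_of_nonneg hr₀]
    exact (mul_le_of_le_one_left (norm_nonneg _) (pow_le_one₀ hr₀ hr₁.le)).trans (hf _ hζ).le
  rw [dist_eq_norm, ← map_sub, hsplit, map_add]
  have h₁ : ‖L (a * D * ρ P * (c α - Φ))‖ ≤ ‖ρ P‖ * (ε / C) := by
    refine (ContinuousMap.norm_toLp_mul_le _ _).trans
      (mul_le_mul ?_ hΦε (norm_nonneg _) (norm_nonneg _))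
    refine (norm_mul_le _ _).trans (mul_le_of_le_one_left (norm_nonneg _) ?_)
    exact (norm_mul_le _ _).trans (mul_le_one₀ ha₁ (norm_nonneg _) hD₁)
  have h₂ : ‖L (a * ρ P * (D * Φ - F) * 1)‖ ≤ ‖ρ P‖ * (ε / C) * ‖L 1‖ := by
    refine (ContinuousMap.norm_toLp_mul_le _ _).trans
      (mul_le_mul_of_nonneg_right ?_ (norm_nonneg _))
    refine (norm_mul_le _ _).trans (mul_le_mul ?_ hDF (norm_nonneg _) (norm_nonneg _))
    exact (norm_mul_le _ _).trans (mul_le_of_le_one_left (norm_nonneg _) ha₁)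
  have h₃ : C * (ε / C) = ε := mul_div_cancel₀ _ hC.ne'
  have h₄ : 0 < ε / C := div_pos hε hC
  calc _ ≤ ‖ρ P‖ * (ε / C) + ‖ρ P‖ * (ε / C) * ‖L 1‖ := (norm_add_le _ _).trans (add_le_add h₁ h₂)
    _ < ‖ρ P‖ * (ε / C) + ‖ρ P‖ * (ε / C) * ‖L 1‖ + ε / C := lt_add_of_pos_right _ h₄
    _ = C * (ε / C) := by ring
    _ = ε := h₃

theorem dense_toLp_image_range (hμ : IsClarkMeasure n φ α μ) [IsFiniteMeasure μ]
    (hφ : IsRationalInner n ((∏ j : Fin n, MvPolynomial.X j) * p) q φ) (hα : ‖α‖ = 1) :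
    Dense (ContinuousMap.toLp 2 (torusMeasure μ) ℂ ''
        ((polyRestrict (torus (Fin n))).range : Set C(torus (Fin n), ℂ))) := by
  let ρ := polyRestrict (torus (Fin n))
  have hrange : Algebra.adjoin ℂ (range fun j => ρ (MvPolynomial.X j)) = ρ.range := by
    have h := AlgHom.map_adjoin ρ (range MvPolynomial.X)
    rw [MvPolynomial.adjoin_range_X, Algebra.map_top, ← range_comp] at h
    exact h.symm
  have hdense := ContinuousMap.dense_toLp_image_adjoin (ν := torusMeasure μ)
    (s := range fun j => ρ (MvPolynomial.X j)) ?_ ?_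
  · rwa [hrange] at hdense
  · intro ζ ζ' h
    obtain ⟨j, hj⟩ : ∃ j, (ζ : EuclideanSpace ℂ (Fin n)) j ≠ (ζ' : EuclideanSpace ℂ (Fin n)) j := by
      by_contra! hc
      exact h (Subtype.ext (PiLp.ext hc))
    refine ⟨_, ⟨ρ (MvPolynomial.X j), StarAlgebra.subset_adjoin ℂ _ ⟨j, rfl⟩, rfl⟩, ?_⟩
    simpa [ρ, polyRestrict_apply, pEval] using hj
  · rintro - ⟨j, rfl⟩ g hg
    rw [hrange] at hg ⊢
    obtain ⟨P, rfl⟩ := hg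
    have h := hμ.conj_prod_mul_mem_closure hφ hα ((∏ i ∈ Finset.univ.erase j, MvPolynomial.X i) * P)
    convert h using 2
    ext ζ
    have hE : star (∏ i ∈ Finset.univ.erase j, (ζ : EuclideanSpace ℂ (Fin n)) i)
        * ∏ i ∈ Finset.univ.erase j, (ζ : EuclideanSpace ℂ (Fin n)) i = 1 := by
      rw [Complex.star_def, mul_comm, Complex.mul_conj,
        Complex.normSq_eq_norm_sq, norm_prod, Finset.prod_congr rfl fun j _ => ζ.2 j]
      simp
    change star (polyRestrict _ _ ζ) * polyRestrict _ P ζ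
      = star (polyRestrict _ _ ζ) * polyRestrict _ _ ζ
    simp only [polyRestrict_apply]
    simp only [pEval, map_mul, map_prod, MvPolynomial.eval_X]
    rw [← Finset.mul_prod_erase _ _ (Finset.mem_univ j), star_mul']
    linear_combination (-star ((ζ : EuclideanSpace ℂ (Fin n)) j) * MvPolynomial.eval
      (fun i => (ζ : EuclideanSpace ℂ (Fin n)) i) P) * hE

end IsClarkMeasure

/-- If `φ = (z₁⋯zₙ · p)/q` is a rational inner function on the polydisc (with `p, q` coprime
and `q` zero-free on `𝔻ⁿ`), then `H²(μ_α) = L²(μ_α)` for every `α ∈ 𝕋` and every Clark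
measure `μ_α` of `φ` at `α`. -/
theorem H2_eq_L2_of_det_factor {n : ℕ} (p q : MvPolynomial (Fin n) ℂ)
    (hcop : ∀ d : MvPolynomial (Fin n) ℂ, d ∣ p → d ∣ q → IsUnit d)
    (hq : ∀ z ∈ polydisc n, pEval q z ≠ 0)
    (φ : EuclideanSpace ℂ (Fin n) → ℂ)
    (hφ : IsRationalInner n ((∏ j : Fin n, MvPolynomial.X j) * p) q φ) :
    ∀ α : ℂ, ‖α‖ = 1 →
      ∀ μ : Measure (EuclideanSpace ℂ (Fin n)), IsClarkMeasure n φ α μ →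
        closure (polyLp n μ) = Set.univ := by
  intro α hα μ hμ
  have := hμ.1
  refine eq_univ_of_forall fun F => Metric.mem_closure_iff.2 fun ε hε => ?_
  have hmp := hμ.measurePreserving_subtype_val
  obtain ⟨-, hP, ⟨-, ⟨P, rfl⟩, rfl⟩⟩ := Metric.dense_iff.1 (hμ.dense_toLp_image_range hφ hα)
    (Lp.compMeasurePreserving (↑) hmp F) ε hε
  have hPμ : MemLp (pEval P) 2 μ := (memLp_two_iff_integrable_sq_norm
    (continuous_pEval P).aestronglyMeasurable).2 (hμ.integrable_of_continuousOn
      ((continuous_pEval P).norm.pow 2).continuousOn)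
  refine ⟨hPμ.toLp _, ⟨P, hPμ.coeFn_toLp⟩, ?_⟩
  rw [← (Lp.isometry_compMeasurePreserving hmp).dist_eq, dist_comm]
  convert Metric.mem_ball.1 hP using 2
  refine Lp.ext ((Lp.coeFn_compMeasurePreserving _ hmp).trans ?_)
  filter_upwards [ContinuousMap.coeFn_toLp (p := 2) (𝕜 := ℂ) (torusMeasure μ)
    (polyRestrict (torus (Fin n)) P), hmp.quasiMeasurePreserving.ae_eq_comp hPμ.coeFn_toLp]
    with ζ h₁ h₂
  rw [h₂]
  exact (polyRestrict_apply _ P ζ).symm.trans h₁.symm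

end
end

section
/- Let n ≥ 2, let φ be a rational inner function on the polydisc 𝔻ⁿ, and suppose that φ does not depend on one of the variables, i.e., there exist j ∈ {1,…,n} and a function ψ on 𝔻^{n−1} such that φ(z) = ψ(z₁,…,z_{j−1},z_{j+1},…,zₙ) for all z ∈ 𝔻ⁿ. Then for every α ∈ 𝕋 and every Clark measure μ_α of φ at α one has H²(μ_α) ≠ L²(μ_α). -/
open MeasureTheory Filter Set
open scoped ENNReal

noncomputable section

section PoissonKernel

open Complex

theorem norm_sub_half_mul_comm {c ζ : ℂ} (hc : ‖c‖ = 1) (hζ : ‖ζ‖ = 1) :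
    ‖ζ - 2⁻¹ * c‖ = ‖c - 2⁻¹ * ζ‖ := by
  have h1 : c.re * c.re + c.im * c.im = 1 := by rw [← normSq_apply, ← Complex.sq_norm, hc, one_pow]
  have h2 : ζ.re * ζ.re + ζ.im * ζ.im = 1 := by rw [← normSq_apply, ← Complex.sq_norm, hζ, one_pow]
  rw [← sq_eq_sq₀ (norm_nonneg _) (norm_nonneg _), Complex.sq_norm, Complex.sq_norm,
    normSq_apply, normSq_apply]
  have h3 : (2⁻¹ : ℂ) = ((2⁻¹ : ℝ) : ℂ) := by norm_num
  simp only [h3, sub_re, sub_im, re_ofReal_mul, im_ofReal_mul]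
  linear_combination (3 / 4) * h2 - (3 / 4) * h1

/-- A character on the circle integrates against the Poisson kernel to its harmonic extension. -/
theorem integral_poissonKernel_mul_fourier (m : ℕ) {ζ : ℂ} (hζ : ‖ζ‖ = 1) :
    ∫ t : UnitAddCircle,
        (((1 - ‖(2⁻¹ : ℂ) * fourier 1 t‖ ^ 2) / ‖ζ - 2⁻¹ * fourier 1 t‖ ^ 2 : ℝ) : ℂ) *
          fourier (m : ℤ) t = (2⁻¹ * ζ) ^ m := by
  have hw : (2⁻¹ * ζ : ℂ) ∈ Metric.ball (0 : ℂ) 1 := by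
    simp [hζ]; norm_num
  have hf : DiffContOnCl ℂ (fun z : ℂ => z ^ m) (Metric.ball 0 1) :=
    (differentiable_pow m).diffContOnCl
  have hmul := intervalIntegral.integral_comp_mul_left (a := 0) (b := 1) (c := 2 * Real.pi)
    (fun θ => ((‖circleMap 0 1 θ - 0‖ ^ 2 - ‖2⁻¹ * ζ - 0‖ ^ 2) /
      ‖circleMap 0 1 θ - 0 - (2⁻¹ * ζ - 0)‖ ^ 2) • circleMap 0 1 θ ^ m) Real.two_pi_pos.ne'
  rw [mul_zero, mul_one] at hmul
  rw [← hf.circleAverage_poissonKernel_smul' hw, Real.circleAverage_def, ← hmul,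
    ← UnitAddCircle.intervalIntegral_preimage 0, zero_add]
  refine intervalIntegral.integral_congr fun x _ => ?_
  have h1 : fourier 1 (x : UnitAddCircle) = circleMap 0 1 (2 * Real.pi * x) := by
    rw [fourier_coe_apply, circleMap]
    simp only [Int.cast_one, ofReal_one, zero_add, one_mul, mul_one, div_one, ofReal_mul,
      ofReal_ofNat]
    congr 1
    ring
  have hm : fourier (m : ℤ) (x : UnitAddCircle) = circleMap 0 1 (2 * Real.pi * x) ^ m := by
    rw [← h1, fourier_coe_apply, fourier_coe_apply, ← Complex.exp_nat_mul]
    congr 1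
    push_cast
    ring
  have hc : ‖circleMap 0 1 (2 * Real.pi * x)‖ = 1 := by simp
  simp only [h1, hm, sub_zero, real_smul]
  rw [norm_mul, norm_mul, hc, hζ, norm_sub_half_mul_comm hc hζ, one_pow]

theorem poissonKernel_factor_nonneg {z : ℂ} (hz : ‖z‖ < 1) (ζ : ℂ) :
    0 ≤ (1 - ‖z‖ ^ 2) / ‖ζ - z‖ ^ 2 :=
  div_nonneg (by nlinarith [norm_nonneg z]) (by positivity)

theorem poissonKernel_factor_le {z ζ : ℂ} (hz : ‖z‖ = 2⁻¹) (hζ : ‖ζ‖ = 1) :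
    (1 - ‖z‖ ^ 2) / ‖ζ - z‖ ^ 2 ≤ 3 := by
  have h : (2⁻¹ : ℝ) ≤ ‖ζ - z‖ := by
    have := norm_sub_norm_le ζ z
    rw [hz, hζ] at this
    linarith
  rw [hz, div_le_iff₀ (by positivity)]
  nlinarith

theorem measurable_poissonKernel_factor {X : Type*} [MeasurableSpace X] {f g : X → ℂ}
    (hf : Measurable f) (hg : Measurable g) :
    Measurable fun x => (1 - ‖g x‖ ^ 2) / ‖f x - g x‖ ^ 2 := by
  fun_prop

end PoissonKernel

theorem norm_fourier_apply (k : ℤ) (t : UnitAddCircle) : ‖fourier k t‖ = 1 :=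
  Circle.norm_coe _

theorem norm_half_mul_fourier_one (t : UnitAddCircle) :
    ‖(2⁻¹ : ℂ) * fourier 1 t‖ = 2⁻¹ := by
  rw [norm_mul, norm_fourier_apply, mul_one, norm_inv, Complex.norm_ofNat]

/-- The point of the polydisc with coordinates of modulus `1/2` and arguments given by `θ`. -/
def halfTorusPoint {n : ℕ} (θ : Fin n → UnitAddCircle) : EuclideanSpace ℂ (Fin n) :=
  WithLp.toLp 2 fun i => 2⁻¹ * fourier 1 (θ i)

theorem halfTorusPoint_mem_polydisc {n : ℕ} (θ : Fin n → UnitAddCircle) :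
    halfTorusPoint θ ∈ polydisc n := fun j => by
  change ‖(2⁻¹ : ℂ) * fourier 1 (θ j)‖ < 1
  rw [norm_half_mul_fourier_one]
  norm_num

section ClarkMeasure

variable {n : ℕ} {φ : EuclideanSpace ℂ (Fin n) → ℂ} {α : ℂ}
  {μ : Measure (EuclideanSpace ℂ (Fin n))}

theorem IsClarkMeasure.ae_mem_torus_s14 (hμ : IsClarkMeasure n φ α μ) :
    ∀ᵐ ζ ∂μ, ζ ∈ torus (Fin n) :=
  hμ.2.1

theorem measurable_coord (i : Fin n) : Measurable fun ζ : EuclideanSpace ℂ (Fin n) => ζ i :=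
  Continuous.measurable (by fun_prop)

theorem IsClarkMeasure.integral_poisson (hμ : IsClarkMeasure n φ α μ)
    {z : EuclideanSpace ℂ (Fin n)} (hz : z ∈ polydisc n) :
    ∫ ζ, ∏ j, (1 - ‖z j‖ ^ 2) / ‖ζ j - z j‖ ^ 2 ∂μ
      = (ENNReal.ofReal ((1 - ‖φ z‖ ^ 2) / ‖α - φ z‖ ^ 2)).toReal := by
  rw [← hμ.2.2 z hz, integral_eq_lintegral_of_nonneg_ae]
  · exact ae_of_all _ fun ζ => Finset.prod_nonneg fun j _ => poissonKernel_factor_nonneg (hz j) _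
  · refine Measurable.aestronglyMeasurable ?_
    exact Finset.measurable_fun_prod _ fun j _ =>
      measurable_poissonKernel_factor (measurable_coord j) measurable_const

/-- A finite product of unimodular coordinates is integrable against a Clark measure. -/
theorem IsClarkMeasure.integrable_monomial (hμ : IsClarkMeasure n φ α μ) (m : Fin n → ℕ) :
    Integrable (fun ζ => ∏ i, ζ i ^ m i) μ := by
  have := hμ.1
  refine Integrable.of_bound (C := 1) ?_ ?_
  · refine Measurable.aestronglyMeasurable ?_
    exact Finset.measurable_fun_prod _ fun j _ => (measurable_coord j).pow_const _
  · filter_upwards [hμ.ae_mem_torus_s14] with ζ hζ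
    simp [norm_prod, hζ _]

theorem apply_halfTorusPoint_add_single {j : Fin n}
    {ψ : EuclideanSpace ℂ {i : Fin n // i ≠ j} → ℂ}
    (hψ : ∀ z ∈ polydisc n, φ z = ψ (deleteCoord j z)) (θ : Fin n → UnitAddCircle)
    (t : UnitAddCircle) :
    φ (halfTorusPoint (θ + Pi.single j t)) = φ (halfTorusPoint θ) := by
  rw [hψ _ (halfTorusPoint_mem_polydisc _), hψ _ (halfTorusPoint_mem_polydisc _)]
  congr 1
  ext i
  change (2⁻¹ : ℂ) * fourier 1 ((θ + Pi.single j t : Fin n → UnitAddCircle) i.1) =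
    2⁻¹ * fourier 1 (θ i.1)
  rw [Pi.add_apply, Pi.single_eq_of_ne i.2, add_zero]

/-- If `φ` does not depend on the `j`-th variable, the moments of its Clark measures involving a
positive power of `ζ j` vanish. -/
theorem IsClarkMeasure.integral_monomial_eq_zero (hμ : IsClarkMeasure n φ α μ) {j : Fin n}
    {ψ : EuclideanSpace ℂ {i : Fin n // i ≠ j} → ℂ}
    (hψ : ∀ z ∈ polydisc n, φ z = ψ (deleteCoord j z)) (m : Fin n → ℕ) (hm : m j ≠ 0) :
    ∫ ζ, ∏ i, ζ i ^ m i ∂μ = 0 := by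
  have := hμ.1
  set K : (Fin n → UnitAddCircle) → EuclideanSpace ℂ (Fin n) → ℂ := fun θ ζ =>
    ∏ i, ((((1 - ‖(2⁻¹ : ℂ) * fourier 1 (θ i)‖ ^ 2) / ‖ζ i - 2⁻¹ * fourier 1 (θ i)‖ ^ 2 : ℝ) : ℂ) *
      fourier (m i : ℤ) (θ i)) with hK
  have hint : Integrable (Function.uncurry K)
      ((volume : Measure (Fin n → UnitAddCircle)).prod μ) := by
    refine Integrable.of_bound (C := 3 ^ n) ?_ ?_
    · refine Measurable.aestronglyMeasurable ?_
      refine Finset.measurable_fun_prod _ fun i _ => ?_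
      have h1 : Measurable fun x : (Fin n → UnitAddCircle) × EuclideanSpace ℂ (Fin n) =>
          x.2 i := (measurable_coord i).comp measurable_snd
      have h2 (k : ℤ) : Measurable fun x : (Fin n → UnitAddCircle) ×
          EuclideanSpace ℂ (Fin n) => fourier k (x.1 i) :=
        (fourier k).continuous.measurable.comp ((measurable_pi_apply i).comp measurable_fst)
      exact (Complex.measurable_ofReal.comp (measurable_poissonKernel_factor h1
        ((h2 1).const_mul _))).mul (h2 (m i))
    · have h : ∀ᵐ x ∂((volume : Measure (Fin n → UnitAddCircle)).prod μ),
          x.2 ∈ torus (Fin n) := Measure.quasiMeasurePreserving_snd.ae hμ.ae_mem_torus_s14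
      filter_upwards [h] with x hx
      simp only [Function.uncurry, hK, norm_prod]
      refine (Finset.prod_le_prod (g := fun _ => (3 : ℝ)) (fun _ _ => norm_nonneg _)
        fun i _ => ?_).trans_eq (by simp)
      rw [norm_mul, norm_fourier_apply, mul_one]
      have hz := norm_half_mul_fourier_one (x.1 i)
      rw [Complex.norm_real, Real.norm_of_nonneg
        (poissonKernel_factor_nonneg (by rw [hz]; norm_num) _)]
      exact poissonKernel_factor_le hz (hx i)
  have hswap := integral_integral_swap hint
  have hleft (θ : Fin n → UnitAddCircle) : ∫ ζ, K θ ζ ∂μ =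
      ((ENNReal.ofReal ((1 - ‖φ (halfTorusPoint θ)‖ ^ 2) /
        ‖α - φ (halfTorusPoint θ)‖ ^ 2)).toReal : ℂ) * ∏ i, fourier (m i : ℤ) (θ i) := by
    simp only [hK, Finset.prod_mul_distrib, integral_mul_const]
    congr 1
    rw [← hμ.integral_poisson (halfTorusPoint_mem_polydisc θ), ← integral_complex_ofReal]
    simp only [halfTorusPoint, Complex.ofReal_prod]
  have hright : ∫ ζ, ∫ θ, K θ ζ ∂volume ∂μ =
      (∏ i, (2⁻¹ : ℂ) ^ m i) * ∫ ζ, ∏ i, ζ i ^ m i ∂μ := by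
    rw [← integral_const_mul]
    refine integral_congr_ae ?_
    filter_upwards [hμ.ae_mem_torus_s14] with ζ hζ
    simp only [hK]
    rw [integral_fintype_prod_volume_eq_prod (fun i (t : UnitAddCircle) =>
      ((((1 - ‖(2⁻¹ : ℂ) * fourier 1 t‖ ^ 2) / ‖ζ i - 2⁻¹ * fourier 1 t‖ ^ 2 : ℝ) : ℂ) *
        fourier (m i : ℤ) t)), ← Finset.prod_mul_distrib]
    refine Finset.prod_congr rfl fun i _ => ?_
    rw [integral_poissonKernel_mul_fourier _ (hζ i), mul_pow]
  have hzero : ∫ θ, ∫ ζ, K θ ζ ∂μ ∂volume = 0 := by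
    simp_rw [hleft]
    refine integral_eq_zero_of_add_right_eq_neg
      (g := Pi.single j ((1 / 2 / ((m j : ℤ) : ℝ) : ℝ) : UnitAddCircle)) fun θ => ?_
    rw [apply_halfTorusPoint_add_single hψ, ← mul_neg]
    congr 1
    rw [← Finset.mul_prod_erase _ _ (Finset.mem_univ j),
      ← Finset.mul_prod_erase _ (fun i => fourier (m i : ℤ) (θ i)) (Finset.mem_univ j), ← neg_mul]
    congr 1
    · rw [Pi.add_apply, Pi.single_eq_same]
      exact fourier_add_half_inv_index (by exact_mod_cast hm) one_pos _
    · refine Finset.prod_congr rfl fun i hi => ?_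
      rw [Pi.add_apply, Pi.single_eq_of_ne (Finset.ne_of_mem_erase hi), add_zero]
  rw [hswap, hright] at hzero
  exact (mul_eq_zero.1 hzero).resolve_left (Finset.prod_ne_zero_iff.2 fun i _ => by simp)

theorem IsClarkMeasure.integral_coord_mul_pEval (hμ : IsClarkMeasure n φ α μ) {j : Fin n}
    {ψ : EuclideanSpace ℂ {i : Fin n // i ≠ j} → ℂ}
    (hψ : ∀ z ∈ polydisc n, φ z = ψ (deleteCoord j z)) (p : MvPolynomial (Fin n) ℂ) :
    ∫ ζ, ζ j * pEval p ζ ∂μ = 0 := by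
  have key (ζ : EuclideanSpace ℂ (Fin n)) : ζ j * pEval p ζ =
      ∑ d ∈ p.support, p.coeff d * ∏ i, ζ i ^ (d + Finsupp.single j 1 : Fin n →₀ ℕ) i := by
    simp only [pEval, MvPolynomial.eval_eq', Finset.mul_sum]
    refine Finset.sum_congr rfl fun d _ => ?_
    simp only [Finsupp.add_apply, pow_add, Finset.prod_mul_distrib]
    have : ∏ i, ζ i ^ (Finsupp.single j 1 : Fin n →₀ ℕ) i = ζ j := by
      rw [Finset.prod_eq_single j] <;> simp +contextual [eq_comm]
    rw [this]
    ring
  simp_rw [key]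
  rw [integral_finsetSum _ fun d _ => (hμ.integrable_monomial _).const_mul _]
  refine Finset.sum_eq_zero fun d _ => ?_
  rw [integral_const_mul, hμ.integral_monomial_eq_zero hψ _ (by simp), mul_zero]

end ClarkMeasure

/-- If a rational inner function on the polydisc (`n ≥ 2`) does not depend on one of the
variables, then `H²(μ_α) ≠ L²(μ_α)` for every `α ∈ 𝕋` and every Clark measure `μ_α`. -/
theorem H2_ne_L2_of_indep_variable {n : ℕ} (hn : 2 ≤ n)
    (φ : EuclideanSpace ℂ (Fin n) → ℂ)
    (hφ : ∃ p q : MvPolynomial (Fin n) ℂ, IsRationalInner n p q φ)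
    (hindep : ∃ (j : Fin n) (ψ : EuclideanSpace ℂ {i : Fin n // i ≠ j} → ℂ),
      ∀ z ∈ polydisc n, φ z = ψ (deleteCoord j z)) :
    ∀ α : ℂ, ‖α‖ = 1 →
      ∀ μ : Measure (EuclideanSpace ℂ (Fin n)), IsClarkMeasure n φ α μ →
        closure (polyLp n μ) ≠ Set.univ := by
  rintro α hα μ hμ hcl
  obtain ⟨p, q, hpq⟩ := hφ
  obtain ⟨j, ψ, hψ⟩ := hindep
  have := hμ.1
  have hmem : MemLp (fun ζ : EuclideanSpace ℂ (Fin n) => star (ζ j)) 2 μ := by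
    refine MemLp.of_bound (C := 1) ?_ ?_
    · have := measurable_coord j
      exact (continuous_star.measurable.comp this).aestronglyMeasurable
    · filter_upwards [hμ.ae_mem_torus_s14] with ζ hζ
      simp [hζ j]
  set f : Lp ℂ 2 μ := hmem.toLp _ with hf
  have hclosed : IsClosed {g : Lp ℂ 2 μ | inner ℂ f g = 0} :=
    isClosed_eq (by fun_prop) continuous_const
  have hsub : closure (polyLp n μ) ⊆ {g : Lp ℂ 2 μ | inner ℂ f g = 0} := by
    refine closure_minimal ?_ hclosed
    rintro g ⟨p, hp⟩
    rw [Set.mem_ofPred_eq, L2.inner_def, ← hμ.integral_coord_mul_pEval hψ p]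
    refine integral_congr_ae ?_
    filter_upwards [hp, hmem.coeFn_toLp] with ζ h1 h2
    rw [h1, hf, h2]
    simp [mul_comm]
  have hf0 : f = 0 := by
    have : f ∈ closure (polyLp n μ) := hcl ▸ Set.mem_univ f
    exact inner_self_eq_zero.1 (hsub this)
  have hμ0 : μ = 0 := by
    have h0 : (fun ζ : EuclideanSpace ℂ (Fin n) => star (ζ j)) =ᵐ[μ] 0 :=
      (MemLp.toLp_eq_toLp_iff hmem MemLp.zero).1 hf0
    refine ae_eq_bot.1 (Filter.eventually_false_iff_eq_bot.1 ?_)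
    filter_upwards [h0, hμ.ae_mem_torus_s14] with ζ h1 h2
    have h3 := h2 j
    simp only [Pi.zero_apply, star_eq_zero] at h1
    simp [h1] at h3
  have h0 : (0 : EuclideanSpace ℂ (Fin n)) ∈ polydisc n := fun j => by simp
  have hP := hμ.2.2 0 h0
  have hlt := hpq.abs_lt_one 0 h0
  have hne : 0 < ‖α - φ 0‖ := norm_pos_iff.2 fun h => by
    rw [← sub_eq_zero.1 h, hα] at hlt
    exact lt_irrefl _ hlt
  rw [hμ0, lintegral_zero_measure, eq_comm, ENNReal.ofReal_eq_zero] at hP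
  have : 0 < (1 - ‖φ 0‖ ^ 2) / ‖α - φ 0‖ ^ 2 :=
    div_pos (by nlinarith [norm_nonneg (φ 0)]) (by positivity)
  linarith

end
end

section
/- Let M be a 2×2 complex matrix whose operator norm (as a linear map from ℓ²(ℂ²) to ℓ²(ℂ²)) is strictly less than 1, with entries M₁₁, M₁₂, M₂₁, M₂₂. Then M₁₁ ≠ 1 and |det M − M₂₂| ≤ 2·|1 − M₁₁|; that is, the rational function φ(M) = (det M − M₂₂)/(1 − M₁₁) is well defined and satisfies |φ(M)| ≤ 2 on the open unit ball for the operator norm. -/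
/-- A contraction on `ℂ²` for the Euclidean norm does not increase the sum of the squared moduli
of the coordinates. -/
theorem norm_sq_add_norm_sq_le_of_norm_toEuclideanCLM_le_one (M : Matrix (Fin 2) (Fin 2) ℂ)
    (hM : ‖Matrix.toEuclideanCLM (𝕜 := ℂ) M‖ ≤ 1) (x y : ℂ) :
    ‖M 0 0 * x + M 0 1 * y‖ ^ 2 + ‖M 1 0 * x + M 1 1 * y‖ ^ 2 ≤ ‖x‖ ^ 2 + ‖y‖ ^ 2 := by
  have h := (Matrix.toEuclideanCLM (𝕜 := ℂ) M).le_of_opNorm_le hM !₂[x, y]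
  rw [one_mul] at h
  have h2 := pow_le_pow_left₀ (norm_nonneg _) h 2
  simpa [EuclideanSpace.norm_sq_eq, Fin.sum_univ_two, Matrix.toEuclideanCLM_toLp,
    Matrix.mulVec, dotProduct] using h2

/-- The transfer function of a contraction on `ℂ²` is bounded by one. -/
theorem norm_det_sub_entry_le_norm_one_sub_entry (M : Matrix (Fin 2) (Fin 2) ℂ)
    (hM : ‖Matrix.toEuclideanCLM (𝕜 := ℂ) M‖ ≤ 1) :
    ‖M.det - M 1 1‖ ≤ ‖1 - M 0 0‖ := by
  have h := norm_sq_add_norm_sq_le_of_norm_toEuclideanCLM_le_one M hM (M 0 1) (1 - M 0 0)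
  have h0 : M 0 0 * M 0 1 + M 0 1 * (1 - M 0 0) = M 0 1 := by ring
  have h1 : M 1 0 * M 0 1 + M 1 1 * (1 - M 0 0) = -(M.det - M 1 1) := by
    rw [Matrix.det_fin_two]; ring
  rw [h0, h1, norm_neg] at h
  exact (abs_le_of_sq_le_sq' (by linarith) (norm_nonneg _)).2

theorem abs_det_sub_entry_le_on_ball (M : Matrix (Fin 2) (Fin 2) ℂ)
    (hM : ‖Matrix.toEuclideanCLM (𝕜 := ℂ) M‖ < 1) :
    M 0 0 ≠ 1 ∧ ‖M.det - M 1 1‖ ≤ 2 * ‖1 - M 0 0‖ := by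
  refine ⟨fun h => ?_, ?_⟩
  · have h1 := (Matrix.toEuclideanCLM (𝕜 := ℂ) M).le_opNorm !₂[1, 0]
    have h2 := PiLp.norm_apply_le (Matrix.toEuclideanCLM (𝕜 := ℂ) M !₂[1, 0]) 0
    have h3 : ‖(!₂[1, 0] : EuclideanSpace ℂ (Fin 2))‖ = 1 := by
      simp [EuclideanSpace.norm_eq, Fin.sum_univ_two]
    have h4 : Matrix.toEuclideanCLM (𝕜 := ℂ) M !₂[1, 0] 0 = 1 := by
      simp [Matrix.toEuclideanCLM_toLp, h]
    rw [h4, norm_one] at h2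
    rw [h3, mul_one] at h1
    linarith
  · linarith [norm_det_sub_entry_le_norm_one_sub_entry M hM.le, norm_nonneg (1 - M 0 0)]
end
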